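/- There exists a constant C > 0, depending only on K0, a, δ, m, L0, ρ0, such that for every L ≥ L0, every ρ ∈ (0,ρ0), and every h1, h2 ∈ X_{L,ρ}: |R[h1](x) − R[h2](x)| ≤ C·ρ·‖h1−h2‖·e^{−(a/ρ)x}·e^{(2m/ρ)(x+Lρ)} for x ≤ −Lρ; |R[h1](x) − R[h2](x)| ≤ C·ρ·‖h1−h2‖·e^{(a+2)L} for −Lρ < x < Lρ; and |R[h1](x) − R[h2](x)| ≤ C·(e^{−aL} + ρ·e^{aL})·‖h1−h2‖·e^{−(1/2)(x−Lρ)} for x ≥ Lρ. -/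

import Mathlib

open Set MeasureTheory Filter

/-- The weight exponent ω. -/
noncomputable def omegaFn (m L ρ x : ℝ) : ℝ :=
  if x ≤ -(L*ρ) then m/ρ*(x+L*ρ) else if x < L*ρ then 0 else -(1/2)*(x - L*ρ)

/-- The norm on the space X_{L,ρ}. -/
noncomputable def normX (m L ρ : ℝ) (h : ℝ → ℝ) : ℝ :=
  ⨆ x : ℝ, |h x| * Real.exp (-(omegaFn m L ρ x))

/-- Membership in the space X_{L,ρ}. -/
def memX (a m L ρ : ℝ) (h : ℝ → ℝ) : Prop :=
  ContinuousOn h {x : ℝ | x ≠ L*ρ} ∧ (∫ x : ℝ, h x) = 1 ∧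
  (1/ρ) * (∫ x : ℝ, Real.exp (-(a/ρ)*x) * h x) = 1/(1+ρ) ∧
  ∀ x : ℝ, |h x| ≤ 2 * Real.exp (omegaFn m L ρ x)

/-- The hypotheses on the coagulation kernel K. -/
def KernelHyp (K : ℝ → ℝ → ℝ) (γ a K0 δ : ℝ) : Prop :=
  γ < 1 ∧ a = 1 - γ ∧
  ContinuousOn (fun p : ℝ × ℝ => K p.1 p.2) (Ioi 0 ×ˢ Ioi 0) ∧
  (∀ x y : ℝ, 0 < x → 0 < y → 0 ≤ K x y) ∧
  (∀ x y : ℝ, 0 < x → 0 < y → K x y = K y x) ∧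
  (∀ x y α : ℝ, 0 < x → 0 < y → 0 < α → K (α*x) (α*y) = α ^ γ * K x y) ∧
  0 < K0 ∧ δ ∈ Ioo 0 (min 1 a) ∧
  ∀ x ∈ Ioo (0:ℝ) 2, |x ^ a * K x 1 - 1| ≤ K0 * x ^ δ

/-- The hypotheses on the fixed parameters m, L0, ρ0. -/
def ParamHyp (a m L0 ρ0 : ℝ) : Prop :=
  max (a+1) (3*a) < m ∧ (1/a) * Real.log (4*m) < L0 ∧ ρ0 ∈ Ioo (0:ℝ) 1

/-- The function Q[h]. -/
noncomputable def Qfun (K : ℝ → ℝ → ℝ) (a ρ : ℝ) (h : ℝ → ℝ) (y : ℝ) : ℝ :=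
  ∫ z : ℝ, Real.exp (a/ρ*(y-z)) * K (Real.exp ((y-z)/ρ)) 1 * h z

/-- The function ψ_ρ[h]. -/
noncomputable def psiFn (K : ℝ → ℝ → ℝ) (a L ρ : ℝ) (h : ℝ → ℝ) (x : ℝ) : ℝ :=
  (1/ρ) * ∫ y in Ioo x (L*ρ), Real.exp (-(a/ρ)*y) * Qfun K a ρ h y

/-- The remainder R[h]. -/
noncomputable def Rfun (K : ℝ → ℝ → ℝ) (a L ρ : ℝ) (h : ℝ → ℝ) (x : ℝ) : ℝ :=
  if x < L*ρ then
    -(1/ρ) * ∫ y in Iio x, ∫ z in Iio (x + ρ * Real.log (1 - Real.exp ((y-x)/ρ))),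
      Real.exp (-(a/ρ)*z) * K (Real.exp ((y-z)/ρ)) 1 * h y * h z
  else
    -(1/ρ) * (∫ y in Ioi x, Real.exp (-(a/ρ)*y) * h y) * (∫ z in Ioi x, h z)
    + (1/ρ) * (∫ y in Iio x, ∫ z in Ioi x,
        (Real.exp (-(a/ρ)*z) * K (Real.exp ((y-z)/ρ)) 1 - Real.exp (-(a/ρ)*y)) * h y * h z)
    + (1/ρ) * (∫ y in Iio x, ∫ z in Ioo (x + ρ * Real.log (1 - Real.exp ((y-x)/ρ))) x,
        Real.exp (-(a/ρ)*z) * K (Real.exp ((y-z)/ρ)) 1 * h y * h z)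

/-- The remainder R̃[h]. -/
noncomputable def Rtil (K : ℝ → ℝ → ℝ) (a L ρ : ℝ) (h : ℝ → ℝ) (x : ℝ) : ℝ :=
  if x < L*ρ then
    Rfun K a L ρ h x - (1/ρ) * ∫ y in Ioo x (L*ρ),
      Real.exp (-(psiFn K a L ρ h x - psiFn K a L ρ h y)) * Real.exp (-(a/ρ)*y) *
        Qfun K a ρ h y * Rfun K a L ρ h y
  else
    Rfun K a L ρ h x - (1/(1+ρ)) * ∫ y in Ioo (L*ρ) x,
      Real.exp ((y-x)/(1+ρ)) * Rfun K a L ρ h y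

/-- Equation (E) in exponential variables. -/
def solvesE (K : ℝ → ℝ → ℝ) (a ρ : ℝ) (h : ℝ → ℝ) : Prop :=
  ∀ x : ℝ, h x = (1/ρ) * ∫ y in Iio x,
    ∫ z in Ioi (x + ρ * Real.log (1 - Real.exp ((y-x)/ρ))),
      Real.exp (-(a/ρ)*z) * K (Real.exp ((y-z)/ρ)) 1 * h y * h z

/-- The decay exponent λ. -/
noncomputable def lamFn (K : ℝ → ℝ → ℝ) (a L ρ : ℝ) (h : ℝ → ℝ) (x : ℝ) : ℝ :=
  if x < L*ρ then -psiFn K a L ρ h x else -(1/2)*(x - L*ρ)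

/-- The remainder H. -/
noncomputable def Hfun (K : ℝ → ℝ → ℝ) (a ρ : ℝ) (h : ℝ → ℝ) (x : ℝ) : ℝ :=
  (1/ρ) * (∫ y in Iio x, ∫ z in Ioi (x + ρ * Real.log (1 - Real.exp ((y-x)/ρ))),
      Real.exp (-(a/ρ)*z) * K (Real.exp ((y-z)/ρ)) 1 * h y * h z)
    - (ρ/(1+ρ)) * h x - (1/(1+ρ)) * ∫ z in Ioi x, h z


/-- Nonnegative measurable function with integral bounded by `B`. -/
structure IB {α : Type*} [MeasureSpace α] (f : α → ℝ) (B : ℝ) : Prop where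
  meas : Measurable f
  nonneg : ∀ x, 0 ≤ f x
  bnn : 0 ≤ B
  bd : ∫⁻ x, ENNReal.ofReal (f x) ≤ ENNReal.ofReal B

theorem IB.add {α : Type*} [MeasureSpace α] {f g : α → ℝ} {B D : ℝ} (hf : IB f B) (hg : IB g D) :
    IB (fun x => f x + g x) (B + D) := by
  refine ⟨hf.meas.add hg.meas, fun x => add_nonneg (hf.nonneg x) (hg.nonneg x),
    add_nonneg hf.bnn hg.bnn, ?_⟩
  simp_rw [fun x => ENNReal.ofReal_add (hf.nonneg x) (hg.nonneg x)]
  rw [lintegral_add_left hf.meas.ennreal_ofReal, ENNReal.ofReal_add hf.bnn hg.bnn]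
  exact add_le_add hf.bd hg.bd

theorem IB.cmul {α : Type*} [MeasureSpace α] {f : α → ℝ} {B : ℝ} (hf : IB f B) {c : ℝ}
    (hc : 0 ≤ c) : IB (fun x => c * f x) (c * B) := by
  refine ⟨hf.meas.const_mul c, fun x => mul_nonneg hc (hf.nonneg x), mul_nonneg hc hf.bnn, ?_⟩
  simp_rw [ENNReal.ofReal_mul hc]
  rw [lintegral_const_mul _ hf.meas.ennreal_ofReal]
  gcongr
  exact hf.bd

theorem IB.prod {f g : ℝ → ℝ} {B D : ℝ} (hf : IB f B) (hg : IB g D) :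
    IB (fun p : ℝ × ℝ => f p.1 * g p.2) (B * D) := by
  refine ⟨(hf.meas.comp measurable_fst).mul (hg.meas.comp measurable_snd),
    fun x => mul_nonneg (hf.nonneg _) (hg.nonneg _), mul_nonneg hf.bnn hg.bnn, ?_⟩
  simp_rw [fun p : ℝ × ℝ => ENNReal.ofReal_mul (q := g p.2) (hf.nonneg p.1)]
  rw [Measure.volume_eq_prod, lintegral_prod_mul hf.meas.ennreal_ofReal.aemeasurable
    hg.meas.ennreal_ofReal.aemeasurable, ENNReal.ofReal_mul hf.bnn]
  exact mul_le_mul' hf.bd hg.bd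

theorem IB.mono {α : Type*} [MeasureSpace α] {f g : α → ℝ} {B : ℝ} (hg : IB g B)
    (hf : Measurable f) (h0 : ∀ x, 0 ≤ f x) (h : ∀ x, f x ≤ g x) : IB f B :=
  ⟨hf, h0, hg.bnn, (lintegral_mono fun x => ENNReal.ofReal_le_ofReal (h x)).trans hg.bd⟩

theorem IB.le {α : Type*} [MeasureSpace α] {f : α → ℝ} {B D : ℝ} (hf : IB f B)
    (h : B ≤ D) : IB f D :=
  ⟨hf.meas, hf.nonneg, hf.bnn.trans h, hf.bd.trans (ENNReal.ofReal_le_ofReal h)⟩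

theorem IB.of_int {f : ℝ → ℝ} {s : Set ℝ} (hs : MeasurableSet s) (hm : Measurable f)
    (h0 : ∀ x, 0 ≤ f x) (hi : IntegrableOn f s) : IB (s.indicator f) (∫ x in s, f x) := by
  refine ⟨hm.indicator hs, fun x => indicator_nonneg (fun x _ => h0 x) x,
    integral_nonneg h0, ?_⟩
  rw [ofReal_integral_eq_lintegral_ofReal hi (Eventually.of_forall h0), ← lintegral_indicator hs]
  refine lintegral_mono fun x => ?_
  by_cases hx : x ∈ s <;> simp [hx]

theorem IB_Iio {c : ℝ} (hc : 0 < c) (t : ℝ) :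
    IB ((Iio t).indicator fun y => Real.exp (c * y)) (Real.exp (c * t) / c) := by
  have := IB.of_int (f := fun y => Real.exp (c * y)) (s := Iio t) measurableSet_Iio
    (by fun_prop) (fun x => (Real.exp_pos _).le)
    ((integrableOn_exp_mul_Iic hc t).mono_set Iio_subset_Iic_self)
  rwa [← integral_Iic_eq_integral_Iio, integral_exp_mul_Iic hc] at this

theorem IB_Ioi {c : ℝ} (hc : 0 < c) (t : ℝ) :
    IB ((Ioi t).indicator fun y => Real.exp (-c * y)) (Real.exp (-c * t) / c) := by
  have := IB.of_int (f := fun y => Real.exp (-c * y)) (s := Ioi t) measurableSet_Ioi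
    (by fun_prop) (fun x => (Real.exp_pos _).le)
    (integrableOn_exp_mul_Ioi (by linarith) t)
  rw [integral_exp_mul_Ioi (by linarith)] at this
  convert this using 1
  field_simp

theorem IB_Ioo {s t : ℝ} (h : s ≤ t) :
    IB ((Ioo s t).indicator fun _ => (1:ℝ)) (t - s) := by
  have := IB.of_int (f := fun _ => (1:ℝ)) (s := Ioo s t) measurableSet_Ioo
    (by fun_prop) (fun x => zero_le_one)
    (by simp)
  convert this using 1
  simp [h]

theorem omega_meas (m L ρ : ℝ) : Measurable (omegaFn m L ρ) := by
  unfold omegaFn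
  refine Measurable.ite measurableSet_Iic (by fun_prop) ?_
  exact Measurable.ite measurableSet_Iio (by fun_prop) (by fun_prop)

theorem omega_le_zero {m L ρ : ℝ} (hm : 0 < m) (hρ : 0 < ρ) (x : ℝ) :
    omegaFn m L ρ x ≤ 0 := by
  unfold omegaFn
  split_ifs with h1 h2
  · exact mul_nonpos_of_nonneg_of_nonpos (by positivity) (by linarith)
  · exact le_rfl
  · linarith

theorem omega_exp_le {m L ρ : ℝ} (hm : 0 < m) (hρ : 0 < ρ) (x : ℝ) :
    Real.exp (omegaFn m L ρ x) ≤ 1 := Real.exp_le_one_iff.2 (omega_le_zero hm hρ x)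

theorem omega_left {m L ρ x : ℝ} (hρ : 0 < ρ) (h : x ≤ -(L*ρ)) :
    omegaFn m L ρ x = m/ρ*x + m*L := by
  unfold omegaFn
  rw [if_pos h]; field_simp

theorem omega_right {m L ρ x : ℝ} (hL : 0 < L) (hρ : 0 < ρ) (h : L*ρ ≤ x) :
    omegaFn m L ρ x = -(1/2)*(x - L*ρ) := by
  unfold omegaFn
  have : 0 < L*ρ := by positivity
  rw [if_neg (by linarith), if_neg (by linarith)]

theorem IB_W {m L ρ b : ℝ} (hρ : 0 < ρ) (hb : 0 < b) (hbm : b < m) :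
    IB (fun y => Real.exp (-(b/ρ)*y) * Real.exp (omegaFn m L ρ y))
      (ρ * Real.exp (b*L) * (1/b + 1/(m-b))) := by
  have h1 := (IB_Iio (c := (m-b)/ρ) (div_pos (by linarith) hρ) (-(L*ρ))).cmul
    (Real.exp_pos (m*L)).le
  have h2 := IB_Ioi (c := b/ρ) (by positivity) (-(L*ρ))
  have h3 := (IB_Ioo (le_refl (0:ℝ)))
  have hm0 : 0 < m - b := by linarith
  have h4 : IB (Set.indicator {-(L*ρ)} fun y => Real.exp (-(b/ρ)*y)) 0 := by
    have := IB.of_int (f := fun y => Real.exp (-(b/ρ)*y)) (s := {-(L*ρ)}) (by simp)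
      (by fun_prop) (fun x => (Real.exp_pos _).le) (by simp)
    simpa using this
  refine ((h1.add (h2.add h4)).mono ?_ (fun x => by positivity) ?_).le (le_of_eq ?_)
  · have := omega_meas m L ρ
    fun_prop
  · intro y
    have n1 := h1.nonneg y
    have n2 := h2.nonneg y
    have n4 := h4.nonneg y
    rcases lt_trichotomy y (-(L*ρ)) with h | h | h
    · refine le_trans (le_of_eq ?_) (le_add_of_nonneg_right (add_nonneg n2 n4))
      rw [indicator_of_mem (by exact h), omega_left hρ h.le, ← Real.exp_add, ← Real.exp_add]
      congr 1; field_simp; ring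
    · refine le_trans ?_ (le_add_of_nonneg_left n1)
      refine le_trans ?_ (le_add_of_nonneg_left n2)
      rw [indicator_of_mem (by simpa using h)]
      exact mul_le_of_le_one_right (Real.exp_pos _).le (omega_exp_le (by linarith) hρ y)
    · refine le_trans ?_ (le_add_of_nonneg_left n1)
      refine le_trans ?_ (le_add_of_nonneg_right n4)
      rw [indicator_of_mem (by exact h)]
      exact mul_le_of_le_one_right (Real.exp_pos _).le (omega_exp_le (by linarith) hρ y)
  · have e1 : Real.exp (m*L) * (Real.exp ((m-b)/ρ * -(L*ρ)) / ((m-b)/ρ))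
        = Real.exp (b*L) * (ρ / (m-b)) := by
      rw [show b*L = m*L + (m-b)/ρ * -(L*ρ) by field_simp; ring, Real.exp_add]
      field_simp
    have e2 : -(b/ρ) * -(L*ρ) = b*L := by field_simp
    rw [e1, e2]; field_simp; ring

theorem key_bound {m L ρ N Bd : ℝ} {h1 h2 : ℝ → ℝ}
    (hm1 : Measurable h1) (hm2 : Measurable h2)
    (hb1 : ∀ x, |h1 x| ≤ 2 * Real.exp (omegaFn m L ρ x))
    (hb2 : ∀ x, |h2 x| ≤ 2 * Real.exp (omegaFn m L ρ x))
    (hN0 : 0 ≤ N)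
    (hN : ∀ x, |h1 x - h2 x| ≤ N * Real.exp (omegaFn m L ρ x))
    {κ : ℝ → ℝ → ℝ} (hκ : Measurable (fun p : ℝ × ℝ => κ p.1 p.2))
    {A : Set ℝ} {B : ℝ → Set ℝ} (hA : MeasurableSet A) (hB : ∀ y, MeasurableSet (B y))
    (hS : MeasurableSet {p : ℝ × ℝ | p.1 ∈ A ∧ p.2 ∈ B p.1})
    {G : ℝ × ℝ → ℝ} (hG : IB G Bd)
    (hdom : ∀ y ∈ A, ∀ z ∈ B y, |κ y z| * Real.exp (omegaFn m L ρ y) * Real.exp (omegaFn m L ρ z)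
      ≤ G (y, z)) :
    |(∫ y in A, ∫ z in B y, κ y z * h1 y * h1 z) - (∫ y in A, ∫ z in B y, κ y z * h2 y * h2 z)|
      ≤ 4 * N * Bd := by
  set S := {p : ℝ × ℝ | p.1 ∈ A ∧ p.2 ∈ B p.1} with hSdef
  let F : (ℝ → ℝ) → ℝ × ℝ → ℝ := fun h => S.indicator fun p => κ p.1 p.2 * h p.1 * h p.2
  have hGi : Integrable G := by
    refine ⟨hG.meas.aestronglyMeasurable, ?_⟩
    rw [hasFiniteIntegral_iff_ofReal (Eventually.of_forall hG.nonneg)]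
    exact hG.bd.trans_lt ENNReal.ofReal_lt_top
  have hGint : ∫ p, G p ≤ Bd := by
    rw [integral_eq_lintegral_of_nonneg_ae (Eventually.of_forall hG.nonneg)
      hG.meas.aestronglyMeasurable]
    exact ENNReal.toReal_le_of_le_ofReal hG.bnn hG.bd
  have hFi : ∀ h : ℝ → ℝ, Measurable h → (∀ x, |h x| ≤ 2 * Real.exp (omegaFn m L ρ x)) →
      Integrable (F h) := by
    intro h hm hb
    refine (hGi.const_mul 4).mono' ?_ (Eventually.of_forall ?_)
    · refine (Measurable.indicator ?_ hS).aestronglyMeasurable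
      exact (hκ.mul (hm.comp measurable_fst)).mul (hm.comp measurable_snd)
    · rintro ⟨y, z⟩
      by_cases hp : (y, z) ∈ S
      · simp only [F, indicator_of_mem hp, Real.norm_eq_abs, abs_mul]
        have h3 := hdom y hp.1 z hp.2
        calc |κ y z| * |h y| * |h z| ≤ |κ y z| * (2 * Real.exp (omegaFn m L ρ y)) *
              (2 * Real.exp (omegaFn m L ρ z)) := by
              gcongr
              · exact hb y
              · exact hb z
          _ = 4 * (|κ y z| * Real.exp (omegaFn m L ρ y) * Real.exp (omegaFn m L ρ z)) := by ring
          _ ≤ _ := by linarith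
      · simp only [F, indicator_of_notMem hp, norm_zero]
        have := hG.nonneg (y, z)
        linarith
  have hFe : ∀ h : ℝ → ℝ, Integrable (F h) →
      (∫ y in A, ∫ z in B y, κ y z * h y * h z) = ∫ p, F h p := by
    intro h hi
    rw [Measure.volume_eq_prod] at hi ⊢
    rw [integral_prod _ hi, ← integral_indicator hA]
    congr 1; ext y
    by_cases hy : y ∈ A
    · rw [indicator_of_mem hy, ← integral_indicator (hB y)]
      congr 1; ext z
      by_cases hz : z ∈ B y
      · have : (y, z) ∈ S := ⟨hy, hz⟩
        simp [F, this, hz]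
      · have : (y, z) ∉ S := fun h => hz h.2
        simp [F, this, hz]
    · rw [indicator_of_notMem hy]
      have : ∀ z, (y, z) ∉ S := fun z h => hy h.1
      simp [F, this]
  have i1 := hFi h1 hm1 hb1
  have i2 := hFi h2 hm2 hb2
  rw [hFe h1 i1, hFe h2 i2, ← integral_sub i1 i2]
  have : ‖∫ p, (F h1 p - F h2 p)‖ ≤ ∫ p, 4 * N * G p := by
    refine norm_integral_le_of_norm_le (hGi.const_mul _) (Eventually.of_forall ?_)
    rintro ⟨y, z⟩
    by_cases hp : (y, z) ∈ S
    · simp only [F, indicator_of_mem hp, Real.norm_eq_abs]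
      have h3 := hdom y hp.1 z hp.2
      calc |κ y z * h1 y * h1 z - κ y z * h2 y * h2 z|
          = |κ y z| * |(h1 y - h2 y) * h1 z + h2 y * (h1 z - h2 z)| := by
            rw [← abs_mul]; congr 1; ring
        _ ≤ |κ y z| * (|h1 y - h2 y| * |h1 z| + |h2 y| * |h1 z - h2 z|) := by
            gcongr
            exact (abs_add_le _ _).trans (by rw [abs_mul, abs_mul])
        _ ≤ |κ y z| * ((N * Real.exp (omegaFn m L ρ y)) * (2 * Real.exp (omegaFn m L ρ z))
            + (2 * Real.exp (omegaFn m L ρ y)) * (N * Real.exp (omegaFn m L ρ z))) := by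
            gcongr
            · exact hN y
            · exact hb1 z
            · exact hb2 y
            · exact hN z
        _ = 4 * N * (|κ y z| * Real.exp (omegaFn m L ρ y) * Real.exp (omegaFn m L ρ z)) := by ring
        _ ≤ _ := by gcongr
    · simp only [F, indicator_of_notMem hp, sub_zero, norm_zero]
      have := hG.nonneg (y, z)
      positivity
  rw [integral_const_mul] at this
  exact this.trans (by gcongr)

theorem kern_cont {K : ℝ → ℝ → ℝ} {γ a K0 δ : ℝ} (hK : KernelHyp K γ a K0 δ) (ρ : ℝ) :
    Continuous (fun p : ℝ × ℝ => Real.exp (-(a/ρ)*p.2) * K (Real.exp ((p.1-p.2)/ρ)) 1) := by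
  obtain ⟨_, _, hc, _⟩ := hK
  have : Continuous (fun p : ℝ × ℝ => K (Real.exp ((p.1-p.2)/ρ)) 1) :=
    hc.comp_continuous (f := fun p : ℝ × ℝ => (Real.exp ((p.1-p.2)/ρ), (1:ℝ)))
      (by fun_prop) (fun p => ⟨Real.exp_pos _, by simp⟩)
  exact Continuous.mul (by fun_prop) this

theorem kern_diff {K : ℝ → ℝ → ℝ} {γ a K0 δ ρ : ℝ} (hK : KernelHyp K γ a K0 δ) (hρ : 0 < ρ)
    {y z : ℝ} (h : y ≤ z) :
    |Real.exp (-(a/ρ)*z) * K (Real.exp ((y-z)/ρ)) 1 - Real.exp (-(a/ρ)*y)|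
      ≤ K0 * (Real.exp (-((a-δ)/ρ)*y) * Real.exp (-(δ/ρ)*z)) := by
  obtain ⟨_, _, _, _, _, _, _, _, hb⟩ := hK
  have hs : Real.exp ((y-z)/ρ) ≤ 1 := Real.exp_le_one_iff.2
    (div_nonpos_of_nonpos_of_nonneg (by linarith) hρ.le)
  have := hb _ ⟨Real.exp_pos ((y-z)/ρ), by linarith⟩
  rw [← Real.exp_mul, ← Real.exp_mul] at this
  have e : Real.exp (-(a/ρ)*z) * K (Real.exp ((y-z)/ρ)) 1 - Real.exp (-(a/ρ)*y)
      = Real.exp (-(a/ρ)*y) * (Real.exp ((y-z)/ρ*a) * K (Real.exp ((y-z)/ρ)) 1 - 1) := by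
    rw [mul_sub, ← mul_assoc, ← Real.exp_add, mul_one]
    congr 3; field_simp; ring
  rw [e, abs_mul, abs_of_pos (Real.exp_pos _)]
  calc _ ≤ Real.exp (-(a/ρ)*y) * (K0 * Real.exp ((y-z)/ρ*δ)) := by gcongr
    _ = K0 * (Real.exp (-(a/ρ)*y) * Real.exp ((y-z)/ρ*δ)) := by ring
    _ = _ := by
      rw [← Real.exp_add, ← Real.exp_add]; congr 2; field_simp; ring

theorem kern_le {K : ℝ → ℝ → ℝ} {γ a K0 δ ρ : ℝ} (hK : KernelHyp K γ a K0 δ) (hρ : 0 < ρ)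
    {y z : ℝ} (h : y ≤ z) :
    |Real.exp (-(a/ρ)*z) * K (Real.exp ((y-z)/ρ)) 1| ≤ (1+K0) * Real.exp (-(a/ρ)*y) := by
  have h1 := kern_diff hK hρ h
  have hK0 : 0 < K0 := hK.2.2.2.2.2.2.1
  have hδ : 0 < δ := hK.2.2.2.2.2.2.2.1.1
  have h2 : Real.exp (-((a-δ)/ρ)*y) * Real.exp (-(δ/ρ)*z) ≤ Real.exp (-(a/ρ)*y) := by
    rw [← Real.exp_add]
    apply Real.exp_le_exp.2
    have : 0 ≤ δ/ρ*(z-y) := mul_nonneg (by positivity) (by linarith)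
    have e : -((a-δ)/ρ)*y + -(δ/ρ)*z = -(a/ρ)*y - δ/ρ*(z-y) := by field_simp; ring
    linarith
  have h3 := abs_sub_abs_le_abs_sub (Real.exp (-(a/ρ)*z) * K (Real.exp ((y-z)/ρ)) 1)
    (Real.exp (-(a/ρ)*y))
  rw [abs_of_pos (Real.exp_pos (-(a/ρ)*y))] at h3
  nlinarith

theorem kern_ge {K : ℝ → ℝ → ℝ} {γ a K0 δ ρ : ℝ} (hK : KernelHyp K γ a K0 δ) (hρ : 0 < ρ)
    {y z : ℝ} (h : z ≤ y) :
    |Real.exp (-(a/ρ)*z) * K (Real.exp ((y-z)/ρ)) 1|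
      ≤ (1+K0) * (Real.exp (1/ρ*y) * Real.exp (-((a+1)/ρ)*z)) := by
  have h1 := kern_le hK hρ h
  obtain ⟨_, ha, _, _, hsym, hhom, _⟩ := hK
  have e1 : K (Real.exp ((y-z)/ρ)) 1 = Real.exp ((y-z)/ρ*γ) * K (Real.exp ((z-y)/ρ)) 1 := by
    have := hhom 1 (Real.exp ((z-y)/ρ)) (Real.exp ((y-z)/ρ)) one_pos (Real.exp_pos _)
      (Real.exp_pos _)
    rw [← Real.exp_add, ← Real.exp_mul, mul_one, ← add_div] at this
    rw [show y - z + (z-y) = 0 by ring, zero_div, Real.exp_zero] at this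
    rw [this, hsym _ _ one_pos (Real.exp_pos _)]
  rw [e1]
  have e2 : Real.exp (-(a/ρ)*z) * (Real.exp ((y-z)/ρ*γ) * K (Real.exp ((z-y)/ρ)) 1)
      = Real.exp (1/ρ*(y-z)) * (Real.exp (-(a/ρ)*y) * K (Real.exp ((z-y)/ρ)) 1) := by
    rw [← mul_assoc, ← mul_assoc, ← Real.exp_add, ← Real.exp_add]
    congr 2; rw [ha]; field_simp; ring
  rw [e2, abs_mul, abs_of_pos (Real.exp_pos _)]
  calc _ ≤ Real.exp (1/ρ*(y-z)) * ((1+K0) * Real.exp (-(a/ρ)*z)) := by gcongr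
    _ = (1+K0) * (Real.exp (1/ρ*(y-z)) * Real.exp (-(a/ρ)*z)) := by ring
    _ = _ := by
      rw [← Real.exp_add, ← Real.exp_add]; congr 2; field_simp; ring

theorem kern_both {K : ℝ → ℝ → ℝ} {γ a K0 δ ρ : ℝ} (hK : KernelHyp K γ a K0 δ) (hρ : 0 < ρ)
    (y z : ℝ) :
    |Real.exp (-(a/ρ)*z) * K (Real.exp ((y-z)/ρ)) 1|
      ≤ (1+K0) * (Real.exp (-(a/ρ)*y) + Real.exp (1/ρ*y) * Real.exp (-((a+1)/ρ)*z)) := by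
  have hK0 : 0 < K0 := hK.2.2.2.2.2.2.1
  rcases le_total y z with h | h
  · refine (kern_le hK hρ h).trans ?_
    gcongr
    exact le_add_of_nonneg_right (by positivity)
  · refine (kern_ge hK hρ h).trans ?_
    gcongr
    exact le_add_of_nonneg_left (by positivity)

theorem normX_bound {m L ρ : ℝ} {h1 h2 : ℝ → ℝ}
    (hb1 : ∀ x, |h1 x| ≤ 2 * Real.exp (omegaFn m L ρ x))
    (hb2 : ∀ x, |h2 x| ≤ 2 * Real.exp (omegaFn m L ρ x)) (x : ℝ) :
    |h1 x - h2 x| ≤ normX m L ρ (fun t => h1 t - h2 t) * Real.exp (omegaFn m L ρ x) := by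
  have hbd : BddAbove (range fun x => |h1 x - h2 x| * Real.exp (-(omegaFn m L ρ x))) := by
    refine ⟨4, ?_⟩
    rintro _ ⟨t, rfl⟩
    have : |h1 t - h2 t| ≤ 4 * Real.exp (omegaFn m L ρ t) := by
      have := abs_sub (h1 t) (h2 t)
      linarith [hb1 t, hb2 t]
    calc _ ≤ 4 * Real.exp (omegaFn m L ρ t) * Real.exp (-(omegaFn m L ρ t)) :=
          mul_le_mul_of_nonneg_right this (Real.exp_pos _).le
      _ = 4 := by rw [mul_assoc, ← Real.exp_add]; simp
  have := le_ciSup hbd x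
  have h2 : |h1 x - h2 x| * Real.exp (-(omegaFn m L ρ x)) ≤ normX m L ρ (fun t => h1 t - h2 t) :=
    this
  rw [Real.exp_neg] at h2
  rwa [← div_eq_mul_inv, div_le_iff₀ (Real.exp_pos _)] at h2

theorem normX_nonneg (m L ρ : ℝ) (h : ℝ → ℝ) : 0 ≤ normX m L ρ h :=
  Real.iSup_nonneg fun _ => by positivity

theorem zlim_le {ρ x y : ℝ} (hρ : 0 < ρ) (hy : y < x) :
    x + ρ * Real.log (1 - Real.exp ((y-x)/ρ)) ≤ x := by
  have h1 : Real.exp ((y-x)/ρ) < 1 := Real.exp_lt_one_iff.2 (div_neg_of_neg_of_pos (by linarith) hρ)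
  have h2 := Real.exp_pos ((y-x)/ρ)
  have : Real.log (1 - Real.exp ((y-x)/ρ)) ≤ 0 := Real.log_nonpos (by linarith) (by linarith)
  nlinarith

theorem zlim_meas (x ρ : ℝ) :
    Measurable (fun p : ℝ × ℝ => x + ρ * Real.log (1 - Real.exp ((p.1-x)/ρ))) := by
  fun_prop

section regions
variable {K : ℝ → ℝ → ℝ} {γ a K0 δ m L ρ N : ℝ} {h1 h2 : ℝ → ℝ}

theorem region1 (hK : KernelHyp K γ a K0 δ) (ha : 0 < a) (hm : a + 1 < m) (hρ : 0 < ρ)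
    (hL : 0 < L)
    (hm1 : Measurable h1) (hm2 : Measurable h2)
    (hb1 : ∀ x, |h1 x| ≤ 2 * Real.exp (omegaFn m L ρ x))
    (hb2 : ∀ x, |h2 x| ≤ 2 * Real.exp (omegaFn m L ρ x))
    (hN0 : 0 ≤ N) (hN : ∀ x, |h1 x - h2 x| ≤ N * Real.exp (omegaFn m L ρ x))
    {x : ℝ} (hx : x ≤ -(L*ρ)) :
    |Rfun K a L ρ h1 x - Rfun K a L ρ h2 x| ≤
      (4 * (1+K0) * (1/((m-a)*m) + 1/((m+1)*(m-a-1)))) * ρ * N * Real.exp (-(a/ρ)*x) *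
        Real.exp ((2*m/ρ)*(x+L*ρ)) := by
  have hK0 : 0 < K0 := hK.2.2.2.2.2.2.1
  have hLρ : 0 < L*ρ := by positivity
  have hma : 0 < m - a := by linarith
  have hma1 : 0 < m - a - 1 := by linarith
  have hm0 : 0 < m := by linarith
  unfold Rfun
  rw [if_pos (by linarith), if_pos (by linarith), ← mul_sub, abs_mul, abs_neg,
    abs_of_pos (by positivity : 0 < 1/ρ)]
  have g1 := (IB_Iio (c := (m-a)/ρ) (by positivity) x).prod (IB_Iio (c := m/ρ) (by positivity) x)
  have g2 := (IB_Iio (c := (m+1)/ρ) (by positivity) x).prod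
    (IB_Iio (c := (m-a-1)/ρ) (by positivity) x)
  have g := (g1.add g2).cmul (c := (1+K0) * Real.exp (2*m*L)) (by positivity)
  have key := key_bound hm1 hm2 hb1 hb2 hN0 hN (kern_cont hK ρ).measurable (A := Iio x)
    (B := fun y => Iio (x + ρ * Real.log (1 - Real.exp ((y-x)/ρ)))) measurableSet_Iio
    (fun _ => measurableSet_Iio)
    ((measurableSet_lt measurable_fst measurable_const).inter
      (measurableSet_lt measurable_snd (zlim_meas x ρ))) g (by
      intro y hy z hz
      have hy : y < x := hy
      have hz : z < x := lt_of_lt_of_le hz (zlim_le hρ hy)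
      simp only [indicator_of_mem (show y ∈ Iio x from hy), indicator_of_mem (show z ∈ Iio x from hz)]
      rw [omega_left hρ (by linarith), omega_left hρ (by linarith)]
      calc _ ≤ ((1+K0) * (Real.exp (-(a/ρ)*y) + Real.exp (1/ρ*y) * Real.exp (-((a+1)/ρ)*z))) *
            Real.exp (m/ρ*y + m*L) * Real.exp (m/ρ*z + m*L) := by
            gcongr
            exact kern_both hK hρ y z
        _ = (1+K0) * (Real.exp (-(a/ρ)*y) * Real.exp (m/ρ*y + m*L) * Real.exp (m/ρ*z + m*L) +
          Real.exp (1/ρ*y) * Real.exp (-((a+1)/ρ)*z) *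
            Real.exp (m/ρ*y + m*L) * Real.exp (m/ρ*z + m*L)) := by ring
        _ = _ := by
          rw [mul_assoc (1+K0), mul_add (Real.exp (2*m*L))]
          simp only [← Real.exp_add]
          apply le_antisymm <;> apply le_of_eq
          all_goals
            congr 3 <;> · field_simp; ring)
  calc _ ≤ 1/ρ * (4 * N * _) := mul_le_mul_of_nonneg_left key (by positivity)
    _ = _ := by
      have e : Real.exp (2*m*L) * (Real.exp ((m-a)/ρ*x) * Real.exp (m/ρ*x))
        = Real.exp (-(a/ρ)*x) * Real.exp ((2*m/ρ)*(x+L*ρ)) := by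
        simp only [← Real.exp_add]; congr 1; field_simp; ring
      have e2 : Real.exp (2*m*L) * (Real.exp ((m+1)/ρ*x) * Real.exp ((m-a-1)/ρ*x))
        = Real.exp (-(a/ρ)*x) * Real.exp ((2*m/ρ)*(x+L*ρ)) := by
        simp only [← Real.exp_add]; congr 1; field_simp; ring
      calc _ = 4 * (1+K0) * ρ * N * (
            (Real.exp (2*m*L) * (Real.exp ((m-a)/ρ*x) * Real.exp (m/ρ*x))) * (1/((m-a)*m)) +
            (Real.exp (2*m*L) * (Real.exp ((m+1)/ρ*x) * Real.exp ((m-a-1)/ρ*x))) *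
              (1/((m+1)*(m-a-1)))) := by field_simp
        _ = _ := by rw [e, e2]; ring

theorem region2 (hK : KernelHyp K γ a K0 δ) (ha : 0 < a) (hm : a + 1 < m) (hρ : 0 < ρ)
    (hL : 0 < L)
    (hm1 : Measurable h1) (hm2 : Measurable h2)
    (hb1 : ∀ x, |h1 x| ≤ 2 * Real.exp (omegaFn m L ρ x))
    (hb2 : ∀ x, |h2 x| ≤ 2 * Real.exp (omegaFn m L ρ x))
    (hN0 : 0 ≤ N) (hN : ∀ x, |h1 x - h2 x| ≤ N * Real.exp (omegaFn m L ρ x))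
    {x : ℝ} (hx : x < L*ρ) :
    |Rfun K a L ρ h1 x - Rfun K a L ρ h2 x| ≤
      (4 * (1+K0) * ((1/a+1/(m-a))*(1+1/(m-1)) + (1/(a+1)+1/(m-(a+1))))) * ρ * N *
        Real.exp ((a+2)*L) := by
  have hK0 : 0 < K0 := hK.2.2.2.2.2.2.1
  have hLρ : 0 < L*ρ := by positivity
  have hm0 : 0 < m := by linarith
  unfold Rfun
  rw [if_pos (by linarith), if_pos (by linarith), ← mul_sub, abs_mul, abs_neg,
    abs_of_pos (by positivity : 0 < 1/ρ)]
  have g1 := (IB_W (L := L) hρ ha (show a < m by linarith)).prod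
    ((IB_W (L := L) hρ one_pos (show 1 < m by linarith)).cmul (Real.exp_pos L).le)
  have g2 := (IB_Iio (c := 1/ρ) (by positivity) (L*ρ)).prod
    (IB_W (L := L) hρ (show 0 < a+1 by linarith) hm)
  have g := (g1.add g2).cmul (c := (1+K0)) (by positivity)
  have key := key_bound hm1 hm2 hb1 hb2 hN0 hN (kern_cont hK ρ).measurable (A := Iio x)
    (B := fun y => Iio (x + ρ * Real.log (1 - Real.exp ((y-x)/ρ)))) measurableSet_Iio
    (fun _ => measurableSet_Iio)
    ((measurableSet_lt measurable_fst measurable_const).inter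
      (measurableSet_lt measurable_snd (zlim_meas x ρ))) g (by
      intro y hy z hz
      have hy : y < x := hy
      have hz : z < x := lt_of_lt_of_le hz (zlim_le hρ hy)
      simp only [indicator_of_mem (show y ∈ Iio (L*ρ) from hy.trans hx)]
      have hwy := omega_exp_le (L := L) hm0 hρ y
      have hez : 1 ≤ Real.exp L * Real.exp (-(1/ρ)*z) := by
        rw [← Real.exp_add]
        apply Real.one_le_exp
        have : L + -(1/ρ)*z = (L*ρ - z)/ρ := by field_simp; ring
        rw [this]
        exact div_nonneg (by linarith) hρ.le
      set wy := Real.exp (omegaFn m L ρ y)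
      set wz := Real.exp (omegaFn m L ρ z) with hwz
      have hwy0 : 0 < wy := Real.exp_pos _
      have hwz0 : 0 < wz := Real.exp_pos _
      calc _ ≤ ((1+K0) * (Real.exp (-(a/ρ)*y) + Real.exp (1/ρ*y) * Real.exp (-((a+1)/ρ)*z))) *
            wy * wz := by
            gcongr
            exact kern_both hK hρ y z
        _ = (1+K0) * (Real.exp (-(a/ρ)*y) * wy * (1 * wz) +
          Real.exp (1/ρ*y) * 1 * (Real.exp (-((a+1)/ρ)*z) * wz) * wy) := by ring
        _ ≤ (1+K0) * (Real.exp (-(a/ρ)*y) * wy * ((Real.exp L * Real.exp (-(1/ρ)*z)) * wz) +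
          Real.exp (1/ρ*y) * 1 * (Real.exp (-((a+1)/ρ)*z) * wz) * 1) := by
            gcongr
        _ = _ := by ring)
  calc _ ≤ 1/ρ * (4 * N * _) := mul_le_mul_of_nonneg_left key (by positivity)
    _ = _ := by
      have e : Real.exp (a*L) * (Real.exp L * Real.exp (1*L)) = Real.exp ((a+2)*L) := by
        simp only [← Real.exp_add]; congr 1; ring
      have e2 : Real.exp (1/ρ*(L*ρ)) * Real.exp ((a+1)*L) = Real.exp ((a+2)*L) := by
        simp only [← Real.exp_add]; congr 1; field_simp; ring
      calc _ = 4 * (1+K0) * (ρ/ρ) * ρ * N * (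
            (Real.exp (a*L) * (Real.exp L * Real.exp (1*L))) * ((1/a+1/(m-a))*(1+1/(m-1))) +
            (Real.exp (1/ρ*(L*ρ)) * Real.exp ((a+1)*L)) * (1/(a+1)+1/(m-(a+1)))) := by
            rw [div_div_eq_mul_div]; ring
        _ = _ := by rw [e, e2, div_self hρ.ne']; ring


theorem IB_shear {g l : ℝ → ℝ} {B : ℝ} (hg : Measurable g) (hg0 : ∀ z, 0 ≤ g z)
    (hl : Measurable l) (h : IB (fun z => g z * l z) B) (x : ℝ) :
    IB (fun p : ℝ × ℝ => g p.2 * {p : ℝ × ℝ | x - l p.2 < p.1 ∧ p.1 < x}.indicator (fun _ => 1) p)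
      B := by
  have hS : MeasurableSet {p : ℝ × ℝ | x - l p.2 < p.1 ∧ p.1 < x} :=
    (measurableSet_lt (by fun_prop) measurable_fst).inter
      (measurableSet_lt measurable_fst measurable_const)
  have hm : Measurable (fun p : ℝ × ℝ =>
      g p.2 * {p : ℝ × ℝ | x - l p.2 < p.1 ∧ p.1 < x}.indicator (fun _ => (1:ℝ)) p) :=
    (hg.comp measurable_snd).mul (measurable_const.indicator hS)
  refine ⟨hm, fun p => mul_nonneg (hg0 _) (indicator_nonneg (fun _ _ => zero_le_one) _), h.bnn, ?_⟩
  rw [Measure.volume_eq_prod, lintegral_prod_symm _ hm.ennreal_ofReal.aemeasurable]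
  refine le_trans (lintegral_mono fun z => ?_) h.bd
  have : ∀ y, ENNReal.ofReal (g z *
      {p : ℝ × ℝ | x - l p.2 < p.1 ∧ p.1 < x}.indicator (fun _ => (1:ℝ)) (y, z))
      = (Ioo (x - l z) x).indicator (fun _ => ENNReal.ofReal (g z)) y := by
    intro y
    by_cases hy : x - l z < y ∧ y < x
    · rw [indicator_of_mem (show (y, z) ∈ {p : ℝ × ℝ | x - l p.2 < p.1 ∧ p.1 < x} from hy),
        indicator_of_mem (show y ∈ Ioo (x - l z) x from hy), mul_one]
    · rw [indicator_of_notMem (show (y, z) ∉ {p : ℝ × ℝ | x - l p.2 < p.1 ∧ p.1 < x} from hy),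
        indicator_of_notMem (show y ∉ Ioo (x - l z) x from hy)]
      simp
  simp only [this]
  rw [lintegral_indicator measurableSet_Ioo, lintegral_const, Measure.restrict_apply_univ,
    Real.volume_Ioo, ← ENNReal.ofReal_mul (hg0 z), sub_sub_cancel]

theorem T1 (ha : 0 < a) (hm : a + 1 < m) (hρ : 0 < ρ)
    (hL : 0 < L)
    (hm1 : Measurable h1) (hm2 : Measurable h2)
    (hb1 : ∀ x, |h1 x| ≤ 2 * Real.exp (omegaFn m L ρ x))
    (hb2 : ∀ x, |h2 x| ≤ 2 * Real.exp (omegaFn m L ρ x))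
    (hN0 : 0 ≤ N) (hN : ∀ x, |h1 x - h2 x| ≤ N * Real.exp (omegaFn m L ρ x))
    {x : ℝ} (hx : L*ρ ≤ x) :
    |(∫ y in Ioi x, Real.exp (-(a/ρ)*y) * h1 y) * (∫ z in Ioi x, h1 z) -
      (∫ y in Ioi x, Real.exp (-(a/ρ)*y) * h2 y) * (∫ z in Ioi x, h2 z)| ≤
      (8/a) * ρ * Real.exp (-a*L) * N * Real.exp (-(1/2)*(x-L*ρ)) := by
  have hm0 : 0 < m := by linarith
  have g := ((IB_Ioi (c := a/ρ) (by positivity) x).prod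
    (IB_Ioi (c := 1/2) (by norm_num) x)).cmul (Real.exp_pos (1/2*(L*ρ))).le
  have key := key_bound hm1 hm2 hb1 hb2 hN0 hN (κ := fun y z => Real.exp (-(a/ρ)*y))
    (by fun_prop) (A := Ioi x) (B := fun y => Ioi x) measurableSet_Ioi
    (fun _ => measurableSet_Ioi)
    ((measurableSet_lt measurable_const measurable_fst).inter
      (measurableSet_lt measurable_const measurable_snd)) g (by
      intro y hy z hz
      simp only [indicator_of_mem hy, indicator_of_mem hz]
      have hwy := omega_exp_le (L := L) hm0 hρ y
      have hz' : x < z := hz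
      rw [omega_right (x := z) hL hρ (by linarith), abs_of_pos (Real.exp_pos _)]
      calc _ ≤ Real.exp (-(a/ρ)*y) * 1 * Real.exp (-(1/2)*(z - L*ρ)) := by gcongr
        _ = _ := by
          simp only [mul_one, ← Real.exp_add]; congr 1; ring)
  simp only [integral_const_mul, integral_mul_const] at key
  refine key.trans ?_
  have e1 : Real.exp (-(a/ρ)*x) ≤ Real.exp (-a*L) := by
    apply Real.exp_le_exp.2
    have : L ≤ x/ρ := (le_div_iff₀ hρ).2 hx
    have e : -(a/ρ)*x = -a*(x/ρ) := by ring
    rw [e]; nlinarith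
  have e2 : Real.exp (1/2*(L*ρ)) * Real.exp (-(1/2)*x) = Real.exp (-(1/2)*(x-L*ρ)) := by
    rw [← Real.exp_add]; congr 1; ring
  calc _ = (8/a) * ρ * Real.exp (-(a/ρ)*x) * N *
        (Real.exp (1/2*(L*ρ)) * Real.exp (-(1/2)*x)) := by field_simp; ring
    _ ≤ _ := by
      rw [e2]; gcongr

theorem T2 (hK : KernelHyp K γ a K0 δ) (ha : 0 < a) (hm : a + 1 < m) (hρ : 0 < ρ)
    (hL : 0 < L)
    (hm1 : Measurable h1) (hm2 : Measurable h2)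
    (hb1 : ∀ x, |h1 x| ≤ 2 * Real.exp (omegaFn m L ρ x))
    (hb2 : ∀ x, |h2 x| ≤ 2 * Real.exp (omegaFn m L ρ x))
    (hN0 : 0 ≤ N) (hN : ∀ x, |h1 x - h2 x| ≤ N * Real.exp (omegaFn m L ρ x))
    {x : ℝ} (hx : L*ρ ≤ x) :
    |(∫ y in Iio x, ∫ z in Ioi x,
        (Real.exp (-(a/ρ)*z) * K (Real.exp ((y-z)/ρ)) 1 - Real.exp (-(a/ρ)*y)) * h1 y * h1 z) -
      (∫ y in Iio x, ∫ z in Ioi x,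
        (Real.exp (-(a/ρ)*z) * K (Real.exp ((y-z)/ρ)) 1 - Real.exp (-(a/ρ)*y)) * h2 y * h2 z)| ≤
      (4 * K0 * (1/(a-δ) + 1/(m-(a-δ))) / δ) * ρ * (ρ * Real.exp (a*L)) * N *
        Real.exp (-(1/2)*(x-L*ρ)) := by
  have hK0 : 0 < K0 := hK.2.2.2.2.2.2.1
  have hδ : 0 < δ := hK.2.2.2.2.2.2.2.1.1
  have hδa : δ < a := hK.2.2.2.2.2.2.2.1.2.trans_le (min_le_right _ _)
  have hm0 : 0 < m := by linarith
  have hs1 : 0 < a - δ := by linarith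
  have hs2 : 0 < m - (a - δ) := by linarith
  set E := Real.exp (-(1/2)*(x-L*ρ)) with hE
  have hE0 : 0 < E := Real.exp_pos _
  have g := ((IB_W (L := L) hρ hs1 (show a - δ < m by linarith)).prod
    (IB_Ioi (c := δ/ρ) (by positivity) x)).cmul (c := K0 * E) (by positivity)
  have key := key_bound hm1 hm2 hb1 hb2 hN0 hN
    (κ := fun y z => Real.exp (-(a/ρ)*z) * K (Real.exp ((y-z)/ρ)) 1 - Real.exp (-(a/ρ)*y))
    ((kern_cont hK ρ).measurable.sub (by fun_prop)) (A := Iio x) (B := fun y => Ioi x)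
    measurableSet_Iio
    (fun _ => measurableSet_Ioi)
    ((measurableSet_lt measurable_fst measurable_const).inter
      (measurableSet_lt measurable_const measurable_snd)) g (by
      intro y hy z hz
      simp only [indicator_of_mem hz]
      have hz' : x < z := hz
      have hy' : y < x := hy
      have hwz : Real.exp (omegaFn m L ρ z) ≤ E := by
        rw [omega_right (x := z) hL hρ (by linarith)]
        apply Real.exp_le_exp.2; linarith
      set wy := Real.exp (omegaFn m L ρ y)
      set wz := Real.exp (omegaFn m L ρ z)
      have hwy0 : 0 < wy := Real.exp_pos _
      have hwz0 : 0 < wz := Real.exp_pos _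
      calc _ ≤ (K0 * (Real.exp (-((a-δ)/ρ)*y) * Real.exp (-(δ/ρ)*z))) * wy * E := by
            gcongr
            exact kern_diff hK hρ (by linarith)
        _ = _ := by ring)
  refine key.trans ?_
  have e1 : Real.exp (-(δ/ρ)*x) * Real.exp ((a-δ)*L) ≤ Real.exp (a*L) := by
    rw [← Real.exp_add]
    apply Real.exp_le_exp.2
    have : L ≤ x/ρ := (le_div_iff₀ hρ).2 hx
    have e : -(δ/ρ)*x = -δ*(x/ρ) := by ring
    rw [e]; nlinarith
  calc _ = (4 * K0 * (1/(a-δ) + 1/(m-(a-δ))) / δ) * ρ *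
        (ρ * (Real.exp (-(δ/ρ)*x) * Real.exp ((a-δ)*L))) * N * E := by
        field_simp
    _ ≤ _ := by
      gcongr

theorem omega_near (hm : 0 < m) (hρ : 0 < ρ) (hρ1 : ρ < 1) (hL : 0 < L) {x t : ℝ}
    (ht : x - ρ < t) :
    Real.exp (omegaFn m L ρ t) ≤ Real.exp (1/2) * Real.exp (-(1/2)*(x-L*ρ)) := by
  rw [← Real.exp_add]
  apply Real.exp_le_exp.2
  rcases le_or_gt (L*ρ) t with h | h
  · rw [omega_right hL hρ h]; linarith
  · have := omega_le_zero (L := L) hm hρ t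
    linarith

theorem T3 (hK : KernelHyp K γ a K0 δ) (ha : 0 < a) (hm : a + 1 < m) (hρ : 0 < ρ) (hρ1 : ρ < 1)
    (hL : 0 < L)
    (hm1 : Measurable h1) (hm2 : Measurable h2)
    (hb1 : ∀ x, |h1 x| ≤ 2 * Real.exp (omegaFn m L ρ x))
    (hb2 : ∀ x, |h2 x| ≤ 2 * Real.exp (omegaFn m L ρ x))
    (hN0 : 0 ≤ N) (hN : ∀ x, |h1 x - h2 x| ≤ N * Real.exp (omegaFn m L ρ x))
    {x : ℝ} :
    |(∫ y in Iio x, ∫ z in Ioo (x + ρ * Real.log (1 - Real.exp ((y-x)/ρ))) x,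
        Real.exp (-(a/ρ)*z) * K (Real.exp ((y-z)/ρ)) 1 * h1 y * h1 z) -
      (∫ y in Iio x, ∫ z in Ioo (x + ρ * Real.log (1 - Real.exp ((y-x)/ρ))) x,
        Real.exp (-(a/ρ)*z) * K (Real.exp ((y-z)/ρ)) 1 * h2 y * h2 z)| ≤
      (12 * (1 + K0) * Real.exp (1/2) * (1/a + 1/(m-a))) * ρ * (ρ * Real.exp (a*L)) * N *
        Real.exp (-(1/2)*(x-L*ρ)) := by
  have hK0 : 0 < K0 := hK.2.2.2.2.2.2.1
  have hm0 : 0 < m := by linarith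
  set E := Real.exp (1/2) * Real.exp (-(1/2)*(x-L*ρ)) with hE
  have hE0 : 0 < E := by positivity
  have hW := (IB_W (L := L) hρ ha (show a < m by linarith))
  have g1 := hW.prod (IB_Ioo (show x - ρ ≤ x by linarith))
  have hom := omega_meas m L ρ
  have g2 := IB_shear
    (g := fun z => Real.exp (1/ρ*x) * Real.exp (-((a+1)/ρ)*z) * Real.exp (omegaFn m L ρ z))
    (l := fun z => 2 * ρ * Real.exp ((z-x)/ρ)) (by fun_prop) (fun z => by positivity)
    (by fun_prop) ((hW.cmul (c := 2*ρ) (by positivity)).mono (by fun_prop)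
      (fun z => by positivity) (fun z => by
        apply le_of_eq
        have : Real.exp (1/ρ*x) * Real.exp (-((a+1)/ρ)*z) * Real.exp ((z-x)/ρ)
          = Real.exp (-(a/ρ)*z) := by
          simp only [← Real.exp_add]; congr 1; field_simp; ring
        rw [← this]; ring)) x
  have g := (g1.add g2).cmul (c := (1+K0) * E) (by positivity)
  have key := key_bound hm1 hm2 hb1 hb2 hN0 hN (kern_cont hK ρ).measurable (A := Iio x)
    (B := fun y => Ioo (x + ρ * Real.log (1 - Real.exp ((y-x)/ρ))) x) measurableSet_Iio
    (fun _ => measurableSet_Ioo)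
    ((measurableSet_lt measurable_fst measurable_const).inter
      ((measurableSet_lt (zlim_meas x ρ) measurable_snd).inter
        (measurableSet_lt measurable_snd measurable_const))) g (by
      intro y hy z hz
      have hy : y < x := hy
      have hzx : z < x := hz.2
      have hYZ : 1 < Real.exp ((y-x)/ρ) + Real.exp ((z-x)/ρ) := by
        have hY1 : Real.exp ((y-x)/ρ) < 1 :=
          Real.exp_lt_one_iff.2 (div_neg_of_neg_of_pos (by linarith) hρ)
        have : Real.log (1 - Real.exp ((y-x)/ρ)) < (z-x)/ρ := by
          rw [lt_div_iff₀ hρ]; linarith [hz.1]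
        rw [Real.log_lt_iff_lt_exp (by linarith)] at this
        linarith
      have near : ∀ t, 1/2 < Real.exp ((t-x)/ρ) → x - ρ < t := by
        intro t ht
        by_contra hc
        have h1 : (t-x)/ρ ≤ -1 := by rw [div_le_iff₀ hρ]; linarith
        have h2 : Real.exp ((t-x)/ρ) ≤ Real.exp (-1) := Real.exp_le_exp.2 h1
        have h3 : (2:ℝ) ≤ Real.exp 1 := by linarith [Real.add_one_le_exp (1:ℝ)]
        rw [Real.exp_neg] at h2
        have h4 : (Real.exp 1)⁻¹ ≤ 2⁻¹ := inv_anti₀ (by norm_num) h3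
        linarith
      have n1 := g1.nonneg (y, z)
      have n2 := g2.nonneg (y, z)
      rcases le_or_gt y z with hyz | hyz
      · have hle : Real.exp ((y-x)/ρ) ≤ Real.exp ((z-x)/ρ) := by gcongr
        have hz2 := near z (by linarith)
        have hwz := omega_near hm0 hρ hρ1 hL hz2
        refine le_trans ?_ (mul_le_mul_of_nonneg_left (le_add_of_nonneg_right n2) (by positivity))
        simp only [indicator_of_mem (show z ∈ Ioo (x-ρ) x from ⟨hz2, hzx⟩)]
        calc _ ≤ ((1+K0) * Real.exp (-(a/ρ)*y)) * Real.exp (omegaFn m L ρ y) * E := by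
              gcongr
              exact kern_le hK hρ hyz
          _ = _ := by ring
      · have hle : Real.exp ((z-x)/ρ) ≤ Real.exp ((y-x)/ρ) := by gcongr
        have hy2 := near y (by linarith)
        have hwy := omega_near hm0 hρ hρ1 hL hy2
        have hmem : x - 2 * ρ * Real.exp ((z-x)/ρ) < y ∧ y < x := by
          refine ⟨?_, hy⟩
          have h1 : (x-y)/ρ + 1 ≤ Real.exp ((x-y)/ρ) := Real.add_one_le_exp _
          have h2 : Real.exp ((x-y)/ρ) * Real.exp ((y-x)/ρ) = 1 := by
            rw [← Real.exp_add, ← add_div]; simp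
          have hp := Real.exp_pos ((x-y)/ρ)
          have h3 : Real.exp ((x-y)/ρ) < 2 := by nlinarith
          have h4 : (x-y)/ρ < 2 * Real.exp ((z-x)/ρ) := by nlinarith [Real.exp_pos ((z-x)/ρ)]
          rw [div_lt_iff₀ hρ] at h4
          linarith
        refine le_trans ?_ (mul_le_mul_of_nonneg_left (le_add_of_nonneg_left n1) (by positivity))
        simp only [indicator_of_mem (show (y, z) ∈
          {p : ℝ × ℝ | x - 2 * ρ * Real.exp ((p.2-x)/ρ) < p.1 ∧ p.1 < x} from hmem)]
        calc _ ≤ ((1+K0) * (Real.exp (1/ρ*y) * Real.exp (-((a+1)/ρ)*z))) * E *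
                Real.exp (omegaFn m L ρ z) := by
              gcongr
              exact kern_ge hK hρ hyz.le
          _ ≤ ((1+K0) * (Real.exp (1/ρ*x) * Real.exp (-((a+1)/ρ)*z))) * E *
                Real.exp (omegaFn m L ρ z) := by
              gcongr
          _ = _ := by ring)
  refine key.trans (le_of_eq ?_)
  rw [hE]; ring

end regions

/-- Lipschitz bounds on the remainder R[h] (estimate (4.11) of the paper). -/
theorem R_lipschitz_bounds
    (γ a K0 δ m L0 ρ0 : ℝ) (hγ : γ < 1) (ha : a = 1 - γ)
    (hK0 : 0 < K0) (hδ : δ ∈ Ioo 0 (min 1 a)) (hP : ParamHyp a m L0 ρ0) :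
    ∃ C : ℝ, 0 < C ∧
      ∀ K : ℝ → ℝ → ℝ, KernelHyp K γ a K0 δ →
      ∀ L : ℝ, L0 ≤ L → ∀ ρ ∈ Ioo (0:ℝ) ρ0,
      ∀ h1 h2 : ℝ → ℝ, memX a m L ρ h1 → memX a m L ρ h2 →
        (∀ x : ℝ, x ≤ -(L*ρ) →
          |Rfun K a L ρ h1 x - Rfun K a L ρ h2 x|
            ≤ C * ρ * normX m L ρ (fun t => h1 t - h2 t)
              * Real.exp (-(a/ρ)*x) * Real.exp ((2*m/ρ)*(x+L*ρ))) ∧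
        (∀ x : ℝ, -(L*ρ) < x → x < L*ρ →
          |Rfun K a L ρ h1 x - Rfun K a L ρ h2 x|
            ≤ C * ρ * normX m L ρ (fun t => h1 t - h2 t) * Real.exp ((a+2)*L)) ∧
        (∀ x : ℝ, L*ρ ≤ x →
          |Rfun K a L ρ h1 x - Rfun K a L ρ h2 x|
            ≤ C * (Real.exp (-a*L) + ρ * Real.exp (a*L))
              * normX m L ρ (fun t => h1 t - h2 t) * Real.exp (-(1/2)*(x-L*ρ))) := by
  obtain ⟨hmax, hL0, hρ0, hρ01⟩ := hP
  have ha0 : 0 < a := by linarith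
  have hm : a + 1 < m := (le_max_left _ _).trans_lt hmax
  have hδ0 : 0 < δ := hδ.1
  have hδa : δ < a := hδ.2.trans_le (min_le_right _ _)
  have hL00 : 0 < L0 := by
    have : 0 < Real.log (4*m) := Real.log_pos (by linarith)
    have : 0 < (1/a) * Real.log (4*m) := by positivity
    linarith
  have p1 : 0 < m - a := by linarith
  have p2 : 0 < m - a - 1 := by linarith
  have p2' : 0 < m - (a + 1) := by linarith
  have p3 : 0 < m - 1 := by linarith
  have p4 : 0 < a - δ := by linarith
  have p5 : 0 < m - (a - δ) := by linarith
  have p6 : 0 < m := by linarith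
  obtain ⟨c1, hc1⟩ : ∃ c, c = 4 * (1+K0) * (1/((m-a)*m) + 1/((m+1)*(m-a-1))) := ⟨_, rfl⟩
  obtain ⟨c2, hc2⟩ : ∃ c, c =
    4 * (1+K0) * ((1/a+1/(m-a))*(1+1/(m-1)) + (1/(a+1)+1/(m-(a+1)))) := ⟨_, rfl⟩
  obtain ⟨c3, hc3⟩ : ∃ c, c = 8/a := ⟨_, rfl⟩
  obtain ⟨c4, hc4⟩ : ∃ c, c = 4 * K0 * (1/(a-δ) + 1/(m-(a-δ))) / δ := ⟨_, rfl⟩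
  obtain ⟨c5, hc5⟩ : ∃ c, c = 12 * (1 + K0) * Real.exp (1/2) * (1/a + 1/(m-a)) := ⟨_, rfl⟩
  have q1 : 0 < c1 := by rw [hc1]; positivity
  have q2 : 0 < c2 := by rw [hc2]; positivity
  have q3 : 0 < c3 := by rw [hc3]; positivity
  have q4 : 0 < c4 := by rw [hc4]; positivity
  have q5 : 0 < c5 := by rw [hc5]; positivity
  refine ⟨c1 + c2 + c3 + c4 + c5, by positivity, ?_⟩
  intro K hK L hL ρ hρ h1 h2 hx1 hx2
  obtain ⟨hρp, hρlt⟩ := hρ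
  have hLp : 0 < L := by linarith
  have hm1 : Measurable h1 := measurable_of_continuousOn_compl_singleton (L*ρ) hx1.1
  have hm2 : Measurable h2 := measurable_of_continuousOn_compl_singleton (L*ρ) hx2.1
  have hb1 := hx1.2.2.2
  have hb2 := hx2.2.2.2
  have hN := normX_bound hb1 hb2
  have hN0 := normX_nonneg m L ρ (fun t => h1 t - h2 t)
  generalize normX m L ρ (fun t => h1 t - h2 t) = N at hN hN0 ⊢
  refine ⟨fun x hx => ?_, fun x _ hx => ?_, fun x hx => ?_⟩
  · refine (region1 hK ha0 hm hρp hLp hm1 hm2 hb1 hb2 hN0 hN hx).trans ?_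
    rw [← hc1]
    gcongr
    linarith
  · refine (region2 hK ha0 hm hρp hLp hm1 hm2 hb1 hb2 hN0 hN hx).trans ?_
    rw [← hc2]
    gcongr
    linarith
  · have t1 := T1 ha0 hm hρp hLp hm1 hm2 hb1 hb2 hN0 hN hx
    have t2 := T2 hK ha0 hm hρp hLp hm1 hm2 hb1 hb2 hN0 hN hx
    have t3 := T3 hK ha0 hm hρp (by linarith) hLp hm1 hm2 hb1 hb2 hN0 hN (x := x)
    rw [← hc3] at t1
    rw [← hc4] at t2
    rw [← hc5] at t3
    unfold Rfun
    rw [if_neg (by linarith), if_neg (by linarith)]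
    have comb : ∀ A1 B1 D1 F1 A2 B2 D2 F2 b1 b2 b3 : ℝ, |A1*B1 - A2*B2| ≤ b1 → |D1 - D2| ≤ b2 →
        |F1 - F2| ≤ b3 →
        |(-(1/ρ)*A1*B1 + (1/ρ)*D1 + (1/ρ)*F1) - (-(1/ρ)*A2*B2 + (1/ρ)*D2 + (1/ρ)*F2)|
          ≤ 1/ρ*(b1+b2+b3) := by
      intro A1 B1 D1 F1 A2 B2 D2 F2 b1 b2 b3 k1 k2 k3
      have e : (-(1/ρ)*A1*B1 + (1/ρ)*D1 + (1/ρ)*F1) - (-(1/ρ)*A2*B2 + (1/ρ)*D2 + (1/ρ)*F2)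
        = 1/ρ*(-(A1*B1 - A2*B2) + (D1-D2) + (F1-F2)) := by ring
      rw [e, abs_mul, abs_of_pos (by positivity : 0 < 1/ρ)]
      refine mul_le_mul_of_nonneg_left ?_ (by positivity)
      have := abs_add_three (-(A1*B1 - A2*B2)) (D1-D2) (F1-F2)
      rw [abs_neg] at this
      linarith
    refine (comb _ _ _ _ _ _ _ _ _ _ _ t1 t2 t3).trans ?_
    have v1 := Real.exp_pos (-a*L)
    have v2 := Real.exp_pos (a*L)
    have v3 := Real.exp_pos (-(1/2)*(x-L*ρ))
    generalize Real.exp (-a*L) = u at *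
    generalize Real.exp (a*L) = v at *
    generalize Real.exp (-(1/2)*(x-L*ρ)) = w at *
    have e : 1/ρ*(c3*ρ*u*N*w + c4*ρ*(ρ*v)*N*w + c5*ρ*(ρ*v)*N*w)
      = (c3 * u + (c4+c5)*(ρ*v)) * N * w := by field_simp; ring
    rw [e]
    gcongr
    have w1 : 0 ≤ (c1+c2+c4+c5)*u := by positivity
    have w2 : 0 ≤ (c1+c2+c3)*(ρ*v) := by positivity
    linarith
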